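/- If z₁ is a unit cyclotomic multiple zeta value of weight p for μ_N and z₂ is a unit cyclotomic multiple zeta value of weight q for μ_N, then z₁·z₂ lies in the ℚ-submodule of ℂ spanned by the unit cyclotomic multiple zeta values of weight p+q for μ_N. In particular, the ℚ-span of all unit cyclotomic multiple zeta values for μ_N is a graded ℚ-subalgebra of the algebra of cyclotomic multiple zeta values. -/

import Mathlib

open Filter Topology

/-- Partial sum of the series defining a cyclotomic multiple zeta value. -/
noncomputable def cmzvPartial (r : ℕ) (k : Fin r → ℕ) (ε : Fin r → ℂ) (M : ℕ) : ℂ :=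
  ∑ n ∈ (Fintype.piFinset fun _ : Fin r => Finset.Icc 1 M).filter
      (fun n => ∀ i j : Fin r, i < j → n i < n j),
    ∏ i, ε i ^ n i / (n i : ℂ) ^ k i

/-- `z` is a unit cyclotomic multiple zeta value for `μ_N` of weight (and depth) `r`, i.e.
`z = ζ(1,…,1; ε₁,…,ε_r)` with all exponents `1`, `εᵢ ∈ μ_N` and `ε_r ≠ 1`. -/
def IsUnitCMZV (N r : ℕ) (z : ℂ) : Prop :=
  ∃ _hr : 1 ≤ r, ∃ ε : Fin r → ℂ,
    (∀ i, ε i ^ N = 1) ∧ ε ⟨r - 1, by omega⟩ ≠ 1 ∧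
    Tendsto (cmzvPartial r (fun _ => 1) ε) atTop (𝓝 z)

namespace UCMZV

/-- Coefficients `d (ε_r, …, ε_1) n = ∑_{n_1 < ⋯ < n_r = n} ∏ ε_i^{n_i} / n_i`. -/
noncomputable def d : List ℂ → ℕ → ℂ
  | [], n => if n = 0 then 1 else 0
  | e :: l, n => e ^ n / (n : ℂ) * ∑ m ∈ Finset.range n, d l m

/-- Partial sums of `d`. -/
noncomputable def A (l : List ℂ) (M : ℕ) : ℂ := ∑ m ∈ Finset.range M, d l m

/-- Iterated integral coefficients. -/
noncomputable def F : List ℂ → PowerSeries ℂ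
  | [] => 1
  | e :: l => PowerSeries.mk fun n =>
      (n : ℂ)⁻¹ * ∑ m ∈ Finset.range n, e ^ (n - m) * PowerSeries.coeff m (F l)

/-- From series letters to integral letters. -/
noncomputable def T : ℂ → List ℂ → List ℂ
  | _, [] => []
  | a, e :: l => (a * e) :: T (a * e) l

/-- From integral letters to series letters. -/
noncomputable def U : ℂ → List ℂ → List ℂ
  | _, [] => []
  | a, e :: l => (e / a) :: U e l

/-- Shuffles. -/
def sh : List ℂ → List ℂ → List (List ℂ)
  | [], v => [v]
  | u, [] => [u]
  | a :: u, b :: v => (sh u (b :: v)).map (a :: ·) ++ (sh (a :: u) v).map (b :: ·)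
termination_by u v => u.length + v.length

lemma coeff_F_T (l : List ℂ) : ∀ (a : ℂ) (n : ℕ),
    PowerSeries.coeff n (F (T a l)) = a ^ n * d l n := by
  induction l with
  | nil =>
    intro a n
    simp only [T, F, d, PowerSeries.coeff_one]
    split_ifs with h <;> simp [h]
  | cons e l ih =>
    intro a n
    simp only [T, F, d, PowerSeries.coeff_mk, ih]
    have : ∑ m ∈ Finset.range n, (a * e) ^ (n - m) * ((a * e) ^ m * d l m)
        = ∑ m ∈ Finset.range n, (a * e) ^ n * d l m := by
      refine Finset.sum_congr rfl fun m hm => ?_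
      rw [← mul_assoc, ← pow_add, Nat.sub_add_cancel (Finset.mem_range.1 hm).le]
    rw [this, ← Finset.mul_sum, mul_pow]
    ring

lemma T_U (l : List ℂ) : ∀ (a : ℂ), a ≠ 0 → (∀ x ∈ l, x ≠ 0) → T a (U a l) = l := by
  induction l with
  | nil => intro a _ _; rfl
  | cons e l ih =>
    intro a ha h
    simp only [T, U]
    rw [mul_div_cancel₀ _ ha, ih e (h e (by simp)) (fun x hx => h x (by simp [hx]))]

lemma U_length (l : List ℂ) : ∀ a, (U a l).length = l.length := by
  induction l with
  | nil => intro a; rfl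
  | cons e l ih => intro a; simp [U, ih]

lemma T_length (l : List ℂ) : ∀ a, (T a l).length = l.length := by
  induction l with
  | nil => intro a; rfl
  | cons e l ih => intro a; simp [T, ih]

lemma U_mu (N : ℕ) (l : List ℂ) : ∀ a, a ^ N = 1 → (∀ x ∈ l, x ^ N = 1) →
    ∀ x ∈ U a l, x ^ N = 1 := by
  induction l with
  | nil => intro a _ _ x hx; simp [U] at hx
  | cons e l ih =>
    intro a ha h x hx
    simp only [U, List.mem_cons] at hx
    rcases hx with rfl | hx
    · rw [div_pow, ha, h e (by simp), div_one]
    · exact ih e (h e (by simp)) (fun y hy => h y (by simp [hy])) x hx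

lemma T_mu (N : ℕ) (l : List ℂ) : ∀ a, a ^ N = 1 → (∀ x ∈ l, x ^ N = 1) →
    ∀ x ∈ T a l, x ^ N = 1 := by
  induction l with
  | nil => intro a _ _ x hx; simp [T] at hx
  | cons e l ih =>
    intro a ha h x hx
    have hae : (a * e) ^ N = 1 := by rw [mul_pow, ha, h e (by simp), one_mul]
    simp only [T, List.mem_cons] at hx
    rcases hx with rfl | hx
    · exact hae
    · exact ih _ hae (fun y hy => h y (by simp [hy])) x hx

lemma deriv_F (e : ℂ) (l : List ℂ) :
    PowerSeries.derivative ℂ (F (e :: l)) = PowerSeries.mk (fun n => e ^ (n + 1)) * F l := by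
  ext n
  rw [PowerSeries.coeff_derivative, mul_comm (PowerSeries.mk _), PowerSeries.coeff_mul,
    Finset.Nat.sum_antidiagonal_eq_sum_range_succ_mk]
  simp only [F, PowerSeries.coeff_mk]
  have : ((n : ℂ) + 1) ≠ 0 := by exact_mod_cast Nat.succ_ne_zero n
  push_cast
  rw [mul_comm, ← mul_assoc, mul_inv_cancel₀ this, one_mul]
  refine Finset.sum_congr rfl fun m hm => ?_
  have := Finset.mem_range.1 hm
  rw [mul_comm, show n + 1 - m = n - m + 1 by omega]

lemma const_F (e : ℂ) (l : List ℂ) : PowerSeries.constantCoeff (F (e :: l)) = 0 := by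
  rw [← PowerSeries.coeff_zero_eq_constantCoeff_apply]
  simp [F]

lemma sum_map_cons_deriv (a : ℂ) (L : List (List ℂ)) :
    PowerSeries.derivative ℂ ((L.map (a :: ·)).map F).sum
      = PowerSeries.mk (fun n => a ^ (n + 1)) * (L.map F).sum := by
  induction L with
  | nil => simp
  | cons w L ih => simp only [List.map_cons, List.sum_cons, map_add, ih, deriv_F, mul_add]

lemma sum_map_cons_const (a : ℂ) (L : List (List ℂ)) :
    PowerSeries.constantCoeff ((L.map (a :: ·)).map F).sum = 0 := by
  induction L with
  | nil => simp
  | cons w L ih => simp only [List.map_cons, List.sum_cons, map_add, ih, const_F, add_zero]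

lemma F_mul (u v : List ℂ) : F u * F v = ((sh u v).map F).sum := by
  induction u, v using sh.induct with
  | case1 v => simp [sh, F]
  | case2 u h =>
    cases u with
    | nil => simp [sh, F]
    | cons a u => simp [sh, F]
  | case3 a u b v ih1 ih2 =>
    apply PowerSeries.derivative.ext
    · rw [sh, List.map_append, List.sum_append, map_add, sum_map_cons_deriv, sum_map_cons_deriv,
        ← ih1, ← ih2, Derivation.leibniz, deriv_F, deriv_F]
      simp only [smul_eq_mul]
      ring
    · rw [sh, List.map_append, List.sum_append, map_add, sum_map_cons_const, sum_map_cons_const,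
        map_mul, const_F]
      simp

lemma sh_length (u v : List ℂ) : ∀ w ∈ sh u v, w.length = u.length + v.length := by
  induction u, v using sh.induct with
  | case1 v => simp [sh]
  | case2 u h => cases u <;> simp [sh]
  | case3 a u b v ih1 ih2 =>
    intro w hw
    rw [sh, List.mem_append, List.mem_map, List.mem_map] at hw
    rcases hw with ⟨w, hw, rfl⟩ | ⟨w, hw, rfl⟩
    · have := ih1 w hw; simp at this ⊢; omega
    · have := ih2 w hw; simp at this ⊢; omega

lemma sh_mem (u v : List ℂ) : ∀ w ∈ sh u v, ∀ x ∈ w, x ∈ u ∨ x ∈ v := by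
  induction u, v using sh.induct with
  | case1 v => simp [sh]
  | case2 u h => cases u <;> simp [sh]
  | case3 a u b v ih1 ih2 =>
    intro w hw x hx
    rw [sh, List.mem_append, List.mem_map, List.mem_map] at hw
    rcases hw with ⟨w, hw, rfl⟩ | ⟨w, hw, rfl⟩
    · have := ih1 w hw x
      simp only [List.mem_cons] at this hx ⊢
      tauto
    · have := ih2 w hw x
      simp only [List.mem_cons] at this hx ⊢
      tauto

lemma sh_head (a : ℂ) (u : List ℂ) (b : ℂ) (v : List ℂ) : ∀ w ∈ sh (a :: u) (b :: v),
    ∃ c t, w = c :: t ∧ (c = a ∨ c = b) := by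
  intro w hw
  rw [sh, List.mem_append, List.mem_map, List.mem_map] at hw
  rcases hw with ⟨w, hw, rfl⟩ | ⟨w, hw, rfl⟩
  · exact ⟨a, w, rfl, Or.inl rfl⟩
  · exact ⟨b, w, rfl, Or.inr rfl⟩

/-! ### Analytic part -/

lemma sum_sqrt (M : ℕ) : ∑ n ∈ Finset.range M, Real.sqrt n / n ≤ 3 * Real.sqrt M := by
  induction M with
  | zero => simp
  | succ M ih =>
    rw [Finset.sum_range_succ]
    rcases Nat.eq_zero_or_pos M with rfl | hM
    · simp
    have h1 : (1 : ℝ) ≤ M := by exact_mod_cast hM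
    have hs : 0 < Real.sqrt M := Real.sqrt_pos.2 (by linarith)
    have hs2 : Real.sqrt M * Real.sqrt M = M := Real.mul_self_sqrt (by linarith)
    have hq : Real.sqrt M / M = 1 / Real.sqrt M := by
      rw [div_eq_div_iff (by linarith) hs.ne', hs2, one_mul]
    have ht : 0 < Real.sqrt (M + 1) := Real.sqrt_pos.2 (by linarith)
    have ht2 : Real.sqrt (M + 1) * Real.sqrt (M + 1) = M + 1 := Real.mul_self_sqrt (by linarith)
    have hlt : Real.sqrt (M + 1) ≤ 2 * Real.sqrt M := by nlinarith
    have key : 1 / Real.sqrt M ≤ 3 * (Real.sqrt (M + 1) - Real.sqrt M) := by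
      rw [div_le_iff₀ hs]
      have : (Real.sqrt (M + 1) - Real.sqrt M) * (Real.sqrt (M + 1) + Real.sqrt M) = 1 := by
        nlinarith
      have h0 : 0 ≤ Real.sqrt (M + 1) - Real.sqrt M := by
        have := Real.sqrt_le_sqrt (show (M : ℝ) ≤ M + 1 by linarith)
        linarith
      nlinarith
    push_cast
    rw [hq]
    linarith

lemma norm_d_le (e : ℂ) (he : ‖e‖ = 1) (l : List ℂ) (C : ℝ)
    (h : ∀ M, ‖A l M‖ ≤ C * Real.sqrt M) (n : ℕ) :
    ‖d (e :: l) n‖ ≤ C * (Real.sqrt n / n) := by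
  have : d (e :: l) n = e ^ n / (n : ℂ) * A l n := rfl
  rw [this, norm_mul, norm_div, norm_pow, he, one_pow, Complex.norm_natCast]
  calc 1 / (n : ℝ) * ‖A l n‖ ≤ 1 / (n : ℝ) * (C * Real.sqrt n) := by
        gcongr
        exact h n
    _ = _ := by ring

lemma norm_A_le (l : List ℂ) (hl : ∀ x ∈ l, ‖x‖ = 1) (M : ℕ) :
    ‖A l M‖ ≤ 3 ^ l.length * Real.sqrt M := by
  induction l generalizing M with
  | nil =>
    rcases Nat.eq_zero_or_pos M with rfl | hM
    · simp [A]
    · have : A [] M = 1 := by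
        simp only [A, d]
        rw [Finset.sum_ite_eq' (Finset.range M) 0 (fun _ => (1 : ℂ))]
        simp [hM]
      rw [this]
      simp only [norm_one, List.length_nil, pow_zero, one_mul]
      exact Real.one_le_sqrt.2 (by exact_mod_cast hM)
  | cons e l ih =>
    have ih' := ih (fun x hx => hl x (by simp [hx]))
    calc ‖A (e :: l) M‖ ≤ ∑ n ∈ Finset.range M, ‖d (e :: l) n‖ := norm_sum_le _ _
      _ ≤ ∑ n ∈ Finset.range M, 3 ^ l.length * (Real.sqrt n / n) :=
        Finset.sum_le_sum fun n _ => norm_d_le e (hl e (by simp)) l _ ih' n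
      _ = 3 ^ l.length * ∑ n ∈ Finset.range M, Real.sqrt n / n := by rw [Finset.mul_sum]
      _ ≤ 3 ^ l.length * (3 * Real.sqrt M) := by gcongr; exact sum_sqrt M
      _ = _ := by rw [List.length_cons, pow_succ]; ring

lemma norm_d_le' (l : List ℂ) (hl : ∀ x ∈ l, ‖x‖ = 1) (n : ℕ) (hn : 1 ≤ n) :
    ‖d l n‖ ≤ 3 ^ l.length * (Real.sqrt n / n) := by
  cases l with
  | nil =>
    have : d [] n = 0 := by simp only [d]; rw [if_neg (by omega)]
    rw [this, norm_zero]; positivity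
  | cons e l =>
    refine (norm_d_le e (hl e (by simp)) l _ (norm_A_le l (fun x hx => hl x (by simp [hx]))) n).trans
      ?_
    gcongr
    · norm_num
    · simp

lemma sqrt_div (n : ℕ) : Real.sqrt n / n = (n : ℝ) ^ (-(1/2) : ℝ) := by
  rw [Real.sqrt_div_self', Real.sqrt_eq_rpow, Real.rpow_neg (by positivity), one_div]

lemma telescoping (b : ℕ → ℂ) (e : ℂ) (M : ℕ) :
    (∑ n ∈ Finset.range M, e ^ n * b n) * (e - 1)
      = b M * e ^ M - b 0 - ∑ n ∈ Finset.range M, (b (n + 1) - b n) * e ^ (n + 1) := by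
  induction M with
  | zero => simp
  | succ M ih =>
    rw [Finset.sum_range_succ, Finset.sum_range_succ, add_mul, ih]
    ring

lemma exists_limit (e : ℂ) (l : List ℂ) (hl : ∀ x ∈ e :: l, ‖x‖ = 1) (he1 : e ≠ 1) :
    ∃ z, Tendsto (A (e :: l)) atTop (𝓝 z) := by
  have hl' : ∀ x ∈ l, ‖x‖ = 1 := fun x hx => hl x (by simp [hx])
  have he : ‖e‖ = 1 := hl e (by simp)
  set C : ℝ := 3 ^ l.length with hC
  have hC0 : 0 ≤ C := by positivity
  set b : ℕ → ℂ := fun n => A l n / n with hb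
  have hb0 : Tendsto (fun n => b n * e ^ n) atTop (𝓝 0) := by
    have hlim : Tendsto (fun n : ℕ => C * (n : ℝ) ^ (-(1/2) : ℝ)) atTop (𝓝 (C * 0)) :=
      ((tendsto_rpow_neg_atTop (by norm_num : (0 : ℝ) < 1/2)).comp
        tendsto_natCast_atTop_atTop).const_mul C
    rw [mul_zero] at hlim
    refine squeeze_zero_norm (fun n => ?_) hlim
    rw [norm_mul, norm_pow, he, one_pow, mul_one, hb, norm_div, Complex.norm_natCast, ← sqrt_div,
      ← mul_div_assoc]
    gcongr
    exact norm_A_le l hl' n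
  have hsum : Summable (fun n => (b (n + 1) - b n) * e ^ (n + 1)) := by
    have hs : Summable (fun n : ℕ => 2 * C * (n : ℝ) ^ (-(3/2) : ℝ)) :=
      (Real.summable_nat_rpow.2 (by norm_num)).mul_left _
    refine Summable.of_norm_bounded_eventually_nat hs ?_
    filter_upwards [eventually_ge_atTop 1] with n hn
    have hn0 : (0 : ℝ) < n := by exact_mod_cast hn
    have hnc : (n : ℂ) ≠ 0 := by exact_mod_cast hn0.ne'
    have hnc1 : (n : ℂ) + 1 ≠ 0 := by exact_mod_cast Nat.succ_ne_zero n
    have hA : A l (n + 1) = A l n + d l n := Finset.sum_range_succ _ _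
    have hdiff : b (n + 1) - b n = d l n / ((n : ℂ) + 1) - A l n / (n * ((n : ℂ) + 1)) := by
      simp only [hb, hA]
      push_cast
      field_simp
      ring
    have hN1 : ‖(n : ℂ) + 1‖ = (n : ℝ) + 1 := by
      have := Complex.norm_natCast (n + 1)
      push_cast at this
      exact this
    have h32 : (n : ℝ) ^ (-(3/2) : ℝ) = Real.sqrt n / n / n := by
      rw [sqrt_div, show (-(3/2) : ℝ) = -(1/2) - 1 by norm_num, Real.rpow_sub_one hn0.ne']
    rw [norm_mul, norm_pow, he, one_pow, mul_one, hdiff]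
    refine (norm_sub_le _ _).trans ?_
    rw [norm_div, norm_div, norm_mul, hN1, Complex.norm_natCast, h32]
    have e1 : ‖d l n‖ / ((n : ℝ) + 1) ≤ C * (Real.sqrt n / n) / n := by
      gcongr
      · exact norm_d_le' l hl' n hn
      · linarith
    have e2 : ‖A l n‖ / ((n : ℝ) * (n + 1)) ≤ C * Real.sqrt n / (n * n) := by
      gcongr
      · exact norm_A_le l hl' n
      · linarith
    have e3 : C * Real.sqrt n / ((n : ℝ) * n) = C * (Real.sqrt n / n / n) := by
      rw [mul_div_assoc, div_div]
    have e4 : C * (Real.sqrt n / n) / (n : ℝ) = C * (Real.sqrt n / n / n) := by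
      rw [mul_div_assoc]
    linarith
  have hS := hsum.hasSum.tendsto_sum_nat
  have hne : e - 1 ≠ 0 := sub_ne_zero.2 he1
  refine ⟨_, (((hb0.sub_const (b 0)).sub hS).div_const (e - 1)).congr fun M => ?_⟩
  rw [← telescoping, mul_div_cancel_right₀ _ hne]
  refine Finset.sum_congr rfl fun n _ => ?_
  simp only [hb]
  change _ = e ^ n / (n : ℂ) * A l n
  ring

/-- Cauchy product and Abel's theorem. -/
lemma abel_mul (f g : PowerSeries ℂ) (z₁ z₂ z : ℂ)
    (hf : Tendsto (fun M => ∑ m ∈ Finset.range M, PowerSeries.coeff m f) atTop (𝓝 z₁))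
    (hg : Tendsto (fun M => ∑ m ∈ Finset.range M, PowerSeries.coeff m g) atTop (𝓝 z₂))
    (hfg : Tendsto (fun M => ∑ m ∈ Finset.range M, PowerSeries.coeff m (f * g)) atTop (𝓝 z)) :
    z₁ * z₂ = z := by
  have aux : ∀ (f : PowerSeries ℂ) (z : ℂ),
      Tendsto (fun M => ∑ m ∈ Finset.range M, PowerSeries.coeff m f) atTop (𝓝 z) →
      ∀ x : ℝ, 0 < x → x < 1 → Summable fun n => ‖PowerSeries.coeff n f * (x : ℂ) ^ n‖ := by
    intro f z hf x hx0 hx1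
    have h0 : Tendsto (fun n => PowerSeries.coeff n f) atTop (𝓝 0) := by
      have := (hf.comp (tendsto_add_atTop_nat 1)).sub hf
      rw [sub_self] at this
      refine this.congr fun n => ?_
      simp [Finset.sum_range_succ]
    have hgeo : Summable fun n : ℕ => x ^ n := summable_geometric_of_lt_one hx0.le hx1
    refine Summable.of_norm_bounded_eventually_nat hgeo ?_
    have := (tendsto_zero_iff_norm_tendsto_zero.1 h0).eventually (gt_mem_nhds one_pos)
    filter_upwards [this] with n hn
    rw [norm_norm, norm_mul, norm_pow, Complex.norm_real, Real.norm_of_nonneg hx0.le]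
    have : 0 ≤ x ^ n := by positivity
    nlinarith
  have h1 := tendsto_map'_iff.1 (Complex.tendsto_tsum_powerSeries_nhdsWithin_lt hf)
  have h2 := tendsto_map'_iff.1 (Complex.tendsto_tsum_powerSeries_nhdsWithin_lt hg)
  have h3 := tendsto_map'_iff.1 (Complex.tendsto_tsum_powerSeries_nhdsWithin_lt hfg)
  refine tendsto_nhds_unique (h1.mul h2) (h3.congr' ?_)
  have hx : ∀ᶠ x : ℝ in 𝓝[<] 1, x ∈ Set.Ioo (0 : ℝ) 1 := Ioo_mem_nhdsLT one_pos
  filter_upwards [hx] with x hx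
  simp only [Function.comp]
  rw [tsum_mul_tsum_eq_tsum_sum_antidiagonal_of_summable_norm (aux f z₁ hf x hx.1 hx.2)
    (aux g z₂ hg x hx.1 hx.2)]
  refine tsum_congr fun n => ?_
  rw [PowerSeries.coeff_mul, Finset.sum_mul]
  refine Finset.sum_congr rfl fun p hp => ?_
  rw [← Finset.HasAntidiagonal.mem_antidiagonal.1 hp, pow_add]
  ring

/-! ### Link with `cmzvPartial` -/

/-- The reversed list of letters. -/
def L : (r : ℕ) → (Fin r → ℂ) → List ℂ
  | 0, _ => []
  | r + 1, ε => ε (Fin.last r) :: L r (fun i => ε i.castSucc)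

lemma L_length (r : ℕ) (ε : Fin r → ℂ) : (L r ε).length = r := by
  induction r with
  | zero => rfl
  | succ r ih => simp [L, ih]

lemma mem_L (r : ℕ) (ε : Fin r → ℂ) (x : ℂ) : x ∈ L r ε ↔ ∃ i, ε i = x := by
  induction r with
  | zero => simp [L]
  | succ r ih =>
    simp only [L, List.mem_cons, ih]
    rw [Fin.exists_fin_succ']
    tauto

lemma L_surj (l : List ℂ) : ∃ ε, L l.length ε = l := by
  induction l with
  | nil => exact ⟨fun _ => 0, rfl⟩
  | cons e l ih =>
    obtain ⟨ε, h⟩ := ih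
    refine ⟨Fin.snoc (α := fun _ => ℂ) ε e, ?_⟩
    simp only [List.length_cons, L, Fin.snoc_last, Fin.snoc_castSucc, h]

lemma partial_succ (r : ℕ) (ε : Fin (r + 1) → ℂ) (M : ℕ) :
    cmzvPartial (r + 1) (fun _ => 1) ε M =
      ∑ m ∈ Finset.Icc 1 M, ε (Fin.last r) ^ m / (m : ℂ) *
        cmzvPartial r (fun _ => 1) (fun i => ε i.castSucc) (m - 1) := by
  unfold cmzvPartial
  simp only [Finset.mul_sum]
  rw [Finset.sum_sigma']
  refine Finset.sum_bij' (fun n _ => ⟨n (Fin.last r), fun i => n i.castSucc⟩)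
    (fun p _ => Fin.snoc (α := fun _ => ℕ) p.2 p.1) ?_ ?_ ?_ ?_ ?_
  · intro n hn
    simp only [Finset.mem_filter, Fintype.mem_piFinset, Finset.mem_Icc, Finset.mem_sigma] at hn ⊢
    refine ⟨hn.1 _, fun i => ⟨(hn.1 _).1, ?_⟩, fun i j hij => hn.2 _ _ (by simpa using hij)⟩
    have := hn.2 i.castSucc (Fin.last r) (Fin.castSucc_lt_last i)
    omega
  · rintro ⟨m, n⟩ hn
    simp only [Finset.mem_filter, Fintype.mem_piFinset, Finset.mem_Icc, Finset.mem_sigma] at hn ⊢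
    obtain ⟨hm, hn1, hn2⟩ := hn
    constructor
    · intro i
      refine Fin.lastCases ?_ (fun i => ?_) i
      · simpa using hm
      · have := hn1 i
        simp only [Fin.snoc_castSucc]
        omega
    · intro i j
      refine Fin.lastCases ?_ (fun j => ?_) j
      · refine Fin.lastCases ?_ (fun i => ?_) i
        · simp
        · intro _
          have := hn1 i
          simp only [Fin.snoc_castSucc, Fin.snoc_last]
          omega
      · refine Fin.lastCases ?_ (fun i => ?_) i
        · intro h
          exact absurd h (not_lt.2 (Fin.castSucc_lt_last j).le)
        · intro h
          simp only [Fin.snoc_castSucc]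
          exact hn2 i j (by simpa using h)
  · intro n _
    funext i
    refine Fin.lastCases ?_ (fun i => ?_) i <;> simp
  · rintro ⟨m, n⟩ _
    simp
  · intro n _
    rw [Fin.prod_univ_castSucc, mul_comm]
    simp

lemma partial_eq_A (r : ℕ) (ε : Fin r → ℂ) (M : ℕ) :
    cmzvPartial r (fun _ => 1) ε M = A (L r ε) (M + 1) := by
  induction r generalizing M with
  | zero =>
    simp [cmzvPartial, A, L, d]
  | succ r ih =>
    rw [partial_succ, A, Finset.sum_range_succ']
    simp only [L, d]
    rw [Finset.range_zero, Finset.sum_empty, mul_zero, add_zero]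
    rw [show Finset.Icc 1 M = Finset.Ico 1 (M + 1) from rfl, Finset.sum_Ico_eq_sum_range]
    refine Finset.sum_congr (by simp) fun m _ => ?_
    rw [ih, add_comm 1 m, Nat.add_sub_cancel, A]

lemma tendsto_iff (r : ℕ) (ε : Fin r → ℂ) (z : ℂ) :
    Tendsto (cmzvPartial r (fun _ => 1) ε) atTop (𝓝 z) ↔ Tendsto (A (L r ε)) atTop (𝓝 z) := by
  rw [← tendsto_add_atTop_iff_nat (f := A (L r ε)) 1]
  exact tendsto_congr fun M => partial_eq_A r ε M

lemma isUnit_iff (N r : ℕ) (z : ℂ) : IsUnitCMZV N r z ↔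
    ∃ e l, (e :: l).length = r ∧ (∀ x ∈ e :: l, x ^ N = 1) ∧ e ≠ 1 ∧
      Tendsto (A (e :: l)) atTop (𝓝 z) := by
  constructor
  · rintro ⟨hr, ε, h1, h2, h3⟩
    obtain ⟨r, rfl⟩ : ∃ s, r = s + 1 := ⟨r - 1, by omega⟩
    refine ⟨ε (Fin.last r), L r (fun i => ε i.castSucc), L_length (r + 1) ε, ?_, h2, ?_⟩
    · intro x hx
      obtain ⟨i, rfl⟩ := (mem_L (r + 1) ε x).1 hx
      exact h1 i
    · exact (tendsto_iff (r + 1) ε z).1 h3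
  · rintro ⟨e, l, rfl, h1, h2, h3⟩
    obtain ⟨ε, hε⟩ := L_surj (e :: l)
    refine ⟨by simp, ε, ?_, ?_, ?_⟩
    · intro i
      exact h1 _ (by rw [← hε]; exact (mem_L _ ε _).2 ⟨i, rfl⟩)
    · have : ε (Fin.last l.length) = e := (List.cons.inj hε).1
      intro h
      exact h2 (this ▸ h)
    · rw [tendsto_iff, hε]
      exact h3

lemma A_eq (l : List ℂ) (M : ℕ) :
    A l M = ∑ m ∈ Finset.range M, PowerSeries.coeff m (F (T 1 l)) := by
  simp [A, coeff_F_T]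

lemma word (N : ℕ) (hN : 1 ≤ N) (c : ℂ) (t : List ℂ) (h : ∀ x ∈ c :: t, x ^ N = 1) (hc : c ≠ 1) :
    ∃ z, IsUnitCMZV N (c :: t).length z ∧
      Tendsto (fun M => ∑ m ∈ Finset.range M, PowerSeries.coeff m (F (c :: t))) atTop (𝓝 z) := by
  have hU : T 1 (U 1 (c :: t)) = c :: t := by
    refine T_U _ 1 one_ne_zero fun x hx h0 => ?_
    have := h x hx
    rw [h0, zero_pow (by omega)] at this
    exact zero_ne_one this
  have hmu := U_mu N (c :: t) 1 (one_pow N) h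
  have hcons : U 1 (c :: t) = c :: U c t := by simp [U]
  have hlen := U_length (c :: t) 1
  rw [hcons] at hU hmu hlen
  obtain ⟨z, hz⟩ := exists_limit c (U c t)
    (fun x hx => Complex.norm_eq_one_of_pow_eq_one (hmu x hx) (by omega)) hc
  refine ⟨z, (isUnit_iff N _ z).2 ⟨c, U c t, hlen, hmu, hc, hz⟩, ?_⟩
  refine hz.congr fun M => ?_
  rw [A_eq, hU]

lemma list_sum (N r : ℕ) (S : List (List ℂ))
    (h : ∀ w ∈ S, ∃ z, IsUnitCMZV N r z ∧
      Tendsto (fun M => ∑ m ∈ Finset.range M, PowerSeries.coeff m (F w)) atTop (𝓝 z)) :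
    ∃ z ∈ Submodule.span ℚ {z : ℂ | IsUnitCMZV N r z},
      Tendsto (fun M => ∑ m ∈ Finset.range M, PowerSeries.coeff m (S.map F).sum) atTop (𝓝 z) := by
  induction S with
  | nil => exact ⟨0, Submodule.zero_mem _, by simp⟩
  | cons w S ih =>
    obtain ⟨z, hz, hzt⟩ := ih fun w hw => h w (by simp [hw])
    obtain ⟨y, hy, hyt⟩ := h w (by simp)
    refine ⟨y + z, Submodule.add_mem _ (Submodule.subset_span hy) hz, ?_⟩
    refine (hyt.add hzt).congr fun M => ?_
    simp [Finset.sum_add_distrib]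

end UCMZV

/-- The product of a unit cyclotomic multiple zeta value of weight `p` with one of weight
`q` lies in the `ℚ`-span of the unit cyclotomic multiple zeta values of weight `p + q`. -/
theorem unit_cmzv_mul_mem (N : ℕ) (hN : 1 ≤ N) (p q : ℕ) (z₁ z₂ : ℂ)
    (h₁ : IsUnitCMZV N p z₁) (h₂ : IsUnitCMZV N q z₂) :
    z₁ * z₂ ∈ Submodule.span ℚ {z : ℂ | IsUnitCMZV N (p + q) z} := by
  obtain ⟨a, u, rfl, hu, ha, hut⟩ := (UCMZV.isUnit_iff N p z₁).1 h₁
  obtain ⟨b, v, rfl, hv, hb, hvt⟩ := (UCMZV.isUnit_iff N q z₂).1 h₂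
  have hTu := UCMZV.T_mu N (a :: u) 1 (one_pow N) hu
  have hTv := UCMZV.T_mu N (b :: v) 1 (one_pow N) hv
  obtain ⟨z, hz, hzt⟩ := UCMZV.list_sum N ((a :: u).length + (b :: v).length)
    (UCMZV.sh (UCMZV.T 1 (a :: u)) (UCMZV.T 1 (b :: v))) (by
      intro w hw
      have hlen := UCMZV.sh_length _ _ w hw
      have hmem := UCMZV.sh_mem _ _ w hw
      rw [UCMZV.T_length, UCMZV.T_length] at hlen
      have hw' := hw
      simp only [UCMZV.T, one_mul] at hw'
      obtain ⟨c, t, rfl, hc⟩ := UCMZV.sh_head _ _ _ _ w hw'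
      rw [← hlen]
      refine UCMZV.word N hN c t (fun x hx => (hmem x hx).elim (hTu x) (hTv x)) ?_
      rcases hc with rfl | rfl <;> assumption)
  rw [← UCMZV.F_mul] at hzt
  have := UCMZV.abel_mul _ _ z₁ z₂ z (hut.congr (UCMZV.A_eq _)) (hvt.congr (UCMZV.A_eq _)) hzt
  rw [this]
  exact hz
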